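/- arXiv:1511.05953 — 4 statements merged into one kernel-verified Lean document; each statement's English description precedes it below -/
import Mathlib

section
/- Third-order expansion of the free Bose gas energy at the critical density: as n → n_fc from below, f₀(n) = f_min + (16π²/3)(n_fc − n)³ + o((n_fc − n)³); equivalently, lim_{n → n_fc⁻} (f₀(n) − f_min)/(n_fc − n)³ = 16π²/3. -/
open MeasureTheory Real Filter

noncomputable section

/-- Momentum space `ℝ³`. -/
abbrev E3 : Type := EuclideanSpace ℝ (Fin 3)

/-- `n_fc = (2π)^{-3} ∫ (e^{p²} - 1)^{-1} dp`. -/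
noncomputable def nfc : ℝ := ((2 * π) ^ 3)⁻¹ * ∫ p : E3, (Real.exp (‖p‖ ^ 2) - 1)⁻¹

/-- `f_min = (2π)^{-3} ∫ ln(1 - e^{-p²}) dp`. -/
noncomputable def fmin : ℝ := ((2 * π) ^ 3)⁻¹ * ∫ p : E3, Real.log (1 - Real.exp (-‖p‖ ^ 2))

/-- `m(n)`: the unique `m ≤ 0` with `(2π)^{-3} ∫ (e^{p² - m} - 1)^{-1} dp = n` when it
exists (i.e. for `0 ≤ n ≤ n_fc`), and `0` otherwise (in particular for `n > n_fc`). -/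
noncomputable def mOf (n : ℝ) : ℝ :=
  letI := Classical.propDecidable
  if h : ∃ m : ℝ, m ≤ 0 ∧ ((2 * π) ^ 3)⁻¹ * (∫ p : E3, (Real.exp (‖p‖ ^ 2 - m) - 1)⁻¹) = n
  then h.choose else 0

/-- Free gas energy `f₀(n) = (2π)^{-3} ∫ ln(1 - e^{-(p² - m(n))}) dp + m(n)·n`. -/
noncomputable def f0 (n : ℝ) : ℝ :=
  ((2 * π) ^ 3)⁻¹ * (∫ p : E3, Real.log (1 - Real.exp (-(‖p‖ ^ 2 - mOf n)))) + mOf n * n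

end

open Topology Set

/-- The Bose factor `(e^x - 1)⁻¹`. -/
noncomputable def boseFactor (x : ℝ) : ℝ := (Real.exp x - 1)⁻¹

/-- The logarithmic free energy density `ln (1 - e^{-x})`. -/
noncomputable def logFactor (x : ℝ) : ℝ := Real.log (1 - Real.exp (-x))

/-- The radial density integral at chemical potential `-t`. -/
noncomputable def radialDensity (t : ℝ) : ℝ :=
  ∫ r in Ioi (0 : ℝ), r ^ 2 * boseFactor (r ^ 2 + t)

/-- The radial pressure integral at chemical potential `-t`. -/
noncomputable def radialLog (t : ℝ) : ℝ :=
  ∫ r in Ioi (0 : ℝ), r ^ 2 * logFactor (r ^ 2 + t)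

lemma measurable_boseFactor : Measurable boseFactor := by
  unfold boseFactor; fun_prop

lemma measurable_logFactor : Measurable logFactor := by
  unfold logFactor; fun_prop

lemma exp_sub_one_pos {x : ℝ} (hx : 0 < x) : 0 < Real.exp x - 1 := by
  linarith [Real.add_one_lt_exp hx.ne']

lemma boseFactor_pos {x : ℝ} (hx : 0 < x) : 0 < boseFactor x :=
  inv_pos.2 (exp_sub_one_pos hx)

lemma boseFactor_le_of_le {x y : ℝ} (hx : 0 < x) (hxy : x ≤ y) :
    boseFactor y ≤ boseFactor x := by
  unfold boseFactor
  have := exp_sub_one_pos hx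
  gcongr

lemma mul_boseFactor_le {x : ℝ} (hx : 0 < x) : x * boseFactor x ≤ 2 * (1 + x)⁻¹ := by
  unfold boseFactor
  rw [← div_eq_mul_inv, ← div_eq_mul_inv, div_le_div_iff₀ (exp_sub_one_pos hx) (by linarith)]
  nlinarith [Real.quadratic_le_exp_of_nonneg hx.le]

lemma boseFactor_sub_le {x t : ℝ} (hx : 0 < x) (ht : 0 < t) (ht1 : t ≤ 1) :
    x * (boseFactor x - boseFactor (x + t)) ≤ 2 * (t / (x + t)) := by
  have h1 := exp_sub_one_pos hx
  have h2 := exp_sub_one_pos (show 0 < x + t by linarith)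
  have hq := Real.quadratic_le_exp_of_nonneg hx.le
  have he : Real.exp (-t) ≤ (1 + t)⁻¹ := by
    rw [Real.exp_neg]
    exact inv_anti₀ (by linarith) (by linarith [Real.add_one_le_exp t])
  have he2 : (1 + t)⁻¹ ≤ 1 - t / 2 := by
    rw [inv_le_iff_one_le_mul₀ (by linarith)]
    nlinarith
  have he3 : 1 - t ≤ Real.exp (-t) := by linarith [Real.add_one_le_exp (-t)]
  have hd : 0 < Real.exp x - Real.exp (-t) := by nlinarith
  have key : boseFactor x - boseFactor (x + t)
      = Real.exp x * (1 - Real.exp (-t)) / ((Real.exp x - 1) * (Real.exp x - Real.exp (-t))) := by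
    have hxt : Real.exp (x + t) - 1 = (Real.exp x - Real.exp (-t)) * Real.exp t := by
      rw [sub_mul, ← Real.exp_add, ← Real.exp_add]; simp
    unfold boseFactor
    rw [hxt]
    have h3 : Real.exp (-t) * Real.exp t = 1 := by rw [← Real.exp_add]; simp
    have h4 := Real.exp_pos t
    field_simp
    linear_combination (Real.exp x - 1) * h3
  have hA : x * Real.exp x ≤ (1 + x) * (Real.exp x - 1) := by nlinarith
  have hB : (1 + x) * (x + t) ≤ 2 * (Real.exp x - Real.exp (-t)) := by nlinarith
  rw [key, ← mul_div_assoc, ← mul_div_assoc, div_le_div_iff₀ (by positivity) (by linarith)]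
  have hC : x * Real.exp x * (x + t) ≤ 2 * ((Real.exp x - 1) * (Real.exp x - Real.exp (-t))) := by
    calc x * Real.exp x * (x + t) ≤ (1 + x) * (Real.exp x - 1) * (x + t) := by gcongr
      _ = (Real.exp x - 1) * ((1 + x) * (x + t)) := by ring
      _ ≤ (Real.exp x - 1) * (2 * (Real.exp x - Real.exp (-t))) := by gcongr
      _ = _ := by ring
  have hE : 0 ≤ 1 - Real.exp (-t) := by linarith
  calc x * (Real.exp x * (1 - Real.exp (-t))) * (x + t)
      = (1 - Real.exp (-t)) * (x * Real.exp x * (x + t)) := by ring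
    _ ≤ (1 - Real.exp (-t)) * (2 * ((Real.exp x - 1) * (Real.exp x - Real.exp (-t)))) := by
        gcongr
    _ ≤ t * (2 * ((Real.exp x - 1) * (Real.exp x - Real.exp (-t)))) := by
        gcongr; linarith
    _ = _ := by ring

lemma hasDerivAt_logFactor {x : ℝ} (hx : 0 < x) : HasDerivAt logFactor (boseFactor x) x := by
  have h0 : 0 < 1 - Real.exp (-x) := by simpa using hx
  have h1 : HasDerivAt (fun y : ℝ => 1 - Real.exp (-y)) (Real.exp (-x)) x := by
    have := ((hasDerivAt_neg x).exp).const_sub 1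
    simpa using this
  have h2 := h1.log h0.ne'
  unfold logFactor
  convert h2 using 1
  unfold boseFactor
  have h3 := exp_sub_one_pos hx
  have h4 : Real.exp (-x) * Real.exp x = 1 := by rw [← Real.exp_add]; simp
  rw [inv_eq_one_div, div_eq_div_iff h3.ne' h0.ne']
  linear_combination -h4

lemma logFactor_nonpos {x : ℝ} (hx : 0 < x) : logFactor x ≤ 0 := by
  apply Real.log_nonpos
  · simpa using hx.le
  · linarith [Real.exp_pos (-x)]

lemma neg_logFactor_le {x : ℝ} (hx : 0 < x) : -logFactor x ≤ boseFactor x := by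
  have h0 : 0 < 1 - Real.exp (-x) := by simpa using hx
  have h := Real.one_sub_inv_le_log_of_pos h0
  have h3 := exp_sub_one_pos hx
  have : (1 - Real.exp (-x))⁻¹ = 1 + boseFactor x := by
    unfold boseFactor
    have h4 : Real.exp (-x) * Real.exp x = 1 := by rw [← Real.exp_add]; simp
    field_simp
    linear_combination h4
  unfold logFactor
  linarith

lemma continuousAt_boseFactor {x : ℝ} (hx : 0 < x) : ContinuousAt boseFactor x := by
  unfold boseFactor
  have := (exp_sub_one_pos hx).ne'
  fun_prop (disch := assumption)

lemma sq_add_pos {r t : ℝ} (hr : r ∈ Ioi (0 : ℝ)) (ht : 0 ≤ t) : 0 < r ^ 2 + t := by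
  have : 0 < r := hr
  positivity

lemma norm_boseFactor_le {r t : ℝ} (hr : r ∈ Ioi (0 : ℝ)) (ht : 0 ≤ t) :
    ‖r ^ 2 * boseFactor (r ^ 2 + t)‖ ≤ 2 * (1 + r ^ 2)⁻¹ := by
  have h0 := sq_add_pos hr le_rfl
  rw [add_zero] at h0
  have h1 := boseFactor_pos (sq_add_pos hr ht)
  rw [Real.norm_of_nonneg (by positivity)]
  refine le_trans ?_ (mul_boseFactor_le h0)
  gcongr
  exact boseFactor_le_of_le h0 (by linarith)

lemma norm_logFactor_le {r t : ℝ} (hr : r ∈ Ioi (0 : ℝ)) (ht : 0 ≤ t) :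
    ‖r ^ 2 * logFactor (r ^ 2 + t)‖ ≤ 2 * (1 + r ^ 2)⁻¹ := by
  refine le_trans ?_ (norm_boseFactor_le hr ht)
  have h1 := sq_add_pos hr ht
  rw [norm_mul, norm_mul]
  gcongr
  rw [Real.norm_of_nonpos (logFactor_nonpos h1), Real.norm_of_nonneg (boseFactor_pos h1).le]
  exact neg_logFactor_le h1

lemma integrable_dominating :
    Integrable (fun r : ℝ => 2 * (1 + r ^ 2)⁻¹) (volume.restrict (Ioi 0)) :=
  (integrable_inv_one_add_sq.const_mul 2).restrict

lemma aestronglyMeasurable_radialDensity (t : ℝ) :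
    AEStronglyMeasurable (fun r : ℝ => r ^ 2 * boseFactor (r ^ 2 + t))
      (volume.restrict (Ioi 0)) := by
  have := measurable_boseFactor
  exact Measurable.aestronglyMeasurable (by fun_prop)

lemma aestronglyMeasurable_radialLog (t : ℝ) :
    AEStronglyMeasurable (fun r : ℝ => r ^ 2 * logFactor (r ^ 2 + t))
      (volume.restrict (Ioi 0)) := by
  have := measurable_logFactor
  exact Measurable.aestronglyMeasurable (by fun_prop)

lemma ae_Ioi_of_forall {p : ℝ → Prop} (h : ∀ r ∈ Ioi (0 : ℝ), p r) :
    ∀ᵐ r ∂(volume.restrict (Ioi (0 : ℝ))), p r :=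
  (ae_restrict_iff' measurableSet_Ioi).2 (Eventually.of_forall h)

lemma integrable_radialDensity {t : ℝ} (ht : 0 ≤ t) :
    Integrable (fun r : ℝ => r ^ 2 * boseFactor (r ^ 2 + t)) (volume.restrict (Ioi 0)) :=
  integrable_dominating.mono' (aestronglyMeasurable_radialDensity t)
    (ae_Ioi_of_forall fun _ hr => norm_boseFactor_le hr ht)

lemma integrable_radialLog {t : ℝ} (ht : 0 ≤ t) :
    Integrable (fun r : ℝ => r ^ 2 * logFactor (r ^ 2 + t)) (volume.restrict (Ioi 0)) :=
  integrable_dominating.mono' (aestronglyMeasurable_radialLog t)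
    (ae_Ioi_of_forall fun _ hr => norm_logFactor_le hr ht)

lemma continuousOn_radialDensity : ContinuousOn radialDensity (Ici 0) := by
  refine continuousOn_of_dominated (bound := fun r => 2 * (1 + r ^ 2)⁻¹)
    (fun t _ => aestronglyMeasurable_radialDensity t)
    (fun t ht => ae_Ioi_of_forall fun r hr => norm_boseFactor_le hr ht)
    integrable_dominating (ae_Ioi_of_forall fun r hr t ht => ?_)
  have h := continuousAt_boseFactor (sq_add_pos hr ht)
  have h2 : ContinuousAt (fun t : ℝ => boseFactor (r ^ 2 + t)) t :=
    ContinuousAt.comp (f := fun t : ℝ => r ^ 2 + t) h (by fun_prop)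
  exact (h2.const_mul _).continuousWithinAt

lemma continuousOn_radialLog : ContinuousOn radialLog (Ici 0) := by
  refine continuousOn_of_dominated (bound := fun r => 2 * (1 + r ^ 2)⁻¹)
    (fun t _ => aestronglyMeasurable_radialLog t)
    (fun t ht => ae_Ioi_of_forall fun r hr => norm_logFactor_le hr ht)
    integrable_dominating (ae_Ioi_of_forall fun r hr t ht => ?_)
  have h := (hasDerivAt_logFactor (sq_add_pos hr ht)).continuousAt
  have h2 : ContinuousAt (fun t : ℝ => logFactor (r ^ 2 + t)) t :=
    ContinuousAt.comp (f := fun t : ℝ => r ^ 2 + t) h (by fun_prop)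
  exact (h2.const_mul _).continuousWithinAt

lemma antitoneOn_radialDensity : AntitoneOn radialDensity (Ici 0) := by
  intro s hs t ht hst
  refine setIntegral_mono_on (integrable_radialDensity ht) (integrable_radialDensity hs)
    measurableSet_Ioi fun r hr => ?_
  gcongr
  exact boseFactor_le_of_le (sq_add_pos hr hs) (by linarith)

lemma hasDerivAt_radialLog {t : ℝ} (ht : 0 < t) :
    HasDerivAt radialLog (radialDensity t) t := by
  refine (hasDerivAt_integral_of_dominated_loc_of_deriv_le (Ioi_mem_nhds ht)
    (Eventually.of_forall aestronglyMeasurable_radialLog) (integrable_radialLog ht.le)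
    (aestronglyMeasurable_radialDensity t)
    (bound := fun r => 2 * (1 + r ^ 2)⁻¹)
    (F' := fun t r => r ^ 2 * boseFactor (r ^ 2 + t))
    (ae_Ioi_of_forall fun r hr s hs => norm_boseFactor_le hr (le_of_lt hs))
    integrable_dominating (ae_Ioi_of_forall fun r hr s hs => ?_)).2
  have h := hasDerivAt_logFactor (sq_add_pos hr (le_of_lt hs))
  exact (h.comp_const_add (r ^ 2) s).const_mul _

lemma tendsto_mul_boseFactor {x : ℝ} (hx : 0 < x) :
    Tendsto (fun t : ℝ => t * boseFactor (t * x)) (𝓝[>] 0) (𝓝 x⁻¹) := by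
  have h1 : HasDerivAt (fun t : ℝ => Real.exp (t * x)) x 0 := by
    simpa using ((hasDerivAt_id (0 : ℝ)).mul_const x).exp
  have h2 := (hasDerivAt_iff_tendsto_slope_zero.1 h1).mono_left
    (nhdsWithin_mono 0 (fun y (hy : y ∈ Ioi (0 : ℝ)) => ne_of_gt hy))
  refine (h2.inv₀ hx.ne').congr fun t => ?_
  simp [boseFactor, mul_comm]

/-- The density deficit behaves like `(π / 2) √t` near criticality. -/
lemma tendsto_density_deficit :
    Tendsto (fun t : ℝ => (radialDensity 0 - radialDensity t) / √t) (𝓝[>] 0) (𝓝 (π / 2)) := by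
  have hlim : (∫ q in Ioi (0 : ℝ), (1 + q ^ 2)⁻¹) = π / 2 := by
    simp [integral_Ioi_inv_one_add_sq]
  rw [← hlim]
  have hev : ∀ᶠ t : ℝ in 𝓝[>] 0, 0 < t ∧ t ≤ 1 := by
    filter_upwards [Ioc_mem_nhdsGT (zero_lt_one' ℝ)] with t ht using ht
  have hscale : ∀ᶠ t : ℝ in 𝓝[>] 0,
      ∫ q in Ioi (0 : ℝ), t * q ^ 2 * (boseFactor (t * q ^ 2) - boseFactor (t * q ^ 2 + t))
        = (radialDensity 0 - radialDensity t) / √t := by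
    filter_upwards [hev] with t ht
    have hs := Real.sqrt_pos.2 ht.1
    have h := integral_comp_mul_left_Ioi
      (fun r : ℝ => r ^ 2 * (boseFactor (r ^ 2) - boseFactor (r ^ 2 + t))) 0 hs
    simp only [mul_pow, Real.sq_sqrt ht.1.le, mul_zero, smul_eq_mul] at h
    rw [h, div_eq_inv_mul]
    congr 1
    unfold radialDensity
    rw [← integral_sub (integrable_radialDensity le_rfl) (integrable_radialDensity ht.1.le)]
    simp [mul_sub]
  refine Tendsto.congr' hscale ?_
  refine tendsto_integral_filter_of_dominated_convergence (fun q => 2 * (1 + q ^ 2)⁻¹)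
    ?_ ?_ integrable_dominating (ae_Ioi_of_forall fun q hq => ?_)
  · have := measurable_boseFactor
    exact Eventually.of_forall fun t => Measurable.aestronglyMeasurable (by fun_prop)
  · filter_upwards [hev] with t ht
    refine ae_Ioi_of_forall fun q hq => ?_
    have hq : 0 < q := hq
    have ht0 := ht.1
    have hx : 0 < t * q ^ 2 := by positivity
    have hle := boseFactor_le_of_le hx (show t * q ^ 2 ≤ t * q ^ 2 + t by linarith)
    rw [Real.norm_of_nonneg (mul_nonneg hx.le (sub_nonneg.2 hle))]
    refine (boseFactor_sub_le hx ht.1 ht.2).trans_eq ?_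
    field_simp
    ring
  · have hq : 0 < q := hq
    have h1 := tendsto_mul_boseFactor (show 0 < q ^ 2 by positivity)
    have h2 := tendsto_mul_boseFactor (show 0 < q ^ 2 + 1 by positivity)
    have h3 := (h1.sub h2).const_mul (q ^ 2)
    have : q ^ 2 * ((q ^ 2)⁻¹ - (q ^ 2 + 1)⁻¹) = (1 + q ^ 2)⁻¹ := by
      field_simp
      ring
    rw [this] at h3
    refine h3.congr fun t => ?_
    rw [mul_add, mul_one]
    ring

lemma tendsto_radialLog_remainder :
    Tendsto (fun t : ℝ => (t * radialDensity 0 - (radialLog t - radialLog 0)) / (t * √t))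
      (𝓝[>] 0) (𝓝 (π / 3)) := by
  have hpos : ∀ᶠ t : ℝ in 𝓝[>] 0, 0 < t := self_mem_nhdsWithin
  refine HasDerivAt.lhopital_zero_nhdsGT
    (f' := fun t => radialDensity 0 - radialDensity t) (g' := fun t => 3 / 2 * √t) ?_ ?_ ?_ ?_ ?_ ?_
  · filter_upwards [hpos] with t ht
    have h1 := ((hasDerivAt_id t).mul_const (radialDensity 0)).sub
      ((hasDerivAt_radialLog ht).sub_const (radialLog 0))
    rw [one_mul] at h1
    exact h1
  · filter_upwards [hpos] with t ht
    have h1 := (hasDerivAt_id t).mul (Real.hasDerivAt_sqrt ht.ne')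
    refine h1.congr_deriv ?_
    have hs := Real.sqrt_pos.2 ht
    have h2 := Real.sq_sqrt ht.le
    simp only [id]
    field_simp
    linear_combination -h2
  · filter_upwards [hpos] with t ht
    have hs := Real.sqrt_pos.2 ht
    positivity
  · have h1 : Tendsto radialLog (𝓝[>] 0) (𝓝 (radialLog 0)) :=
      (continuousOn_radialLog 0 self_mem_Ici).mono_left (nhdsWithin_mono 0 Ioi_subset_Ici_self)
    have h2 : Tendsto (fun t : ℝ => t * radialDensity 0) (𝓝[>] 0) (𝓝 (0 * radialDensity 0)) :=
      (tendsto_id.mono_left nhdsWithin_le_nhds).mul_const _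
    simpa using h2.sub (h1.sub_const (radialLog 0))
  · have h : Continuous fun t : ℝ => t * √t := by fun_prop
    simpa using (h.tendsto 0).mono_left (nhdsWithin_le_nhds (s := Ioi 0))
  · have h := tendsto_density_deficit.mul_const (2 / 3)
    rw [show π / 2 * (2 / 3) = π / 3 by ring] at h
    refine h.congr fun t => ?_
    rw [mul_comm (3 / 2 : ℝ), ← div_div]
    ring

/-- The ratio of the radial energy excess and the cubed radial density deficit. -/
lemma tendsto_energy_ratio :
    Tendsto (fun t : ℝ => (radialLog t - radialLog 0 - t * radialDensity t)
      / (radialDensity 0 - radialDensity t) ^ 3) (𝓝[>] 0) (𝓝 (4 / (3 * π ^ 2))) := by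
  have h := (tendsto_density_deficit.sub tendsto_radialLog_remainder).div
    (tendsto_density_deficit.pow 3) (by positivity)
  have hc : (π / 2 - π / 3) / (π / 2) ^ 3 = 4 / (3 * π ^ 2) := by
    field_simp
    ring
  rw [hc] at h
  refine h.congr' ?_
  filter_upwards [self_mem_nhdsWithin] with t ht
  have ht : 0 < t := ht
  have hs := Real.sqrt_pos.2 ht
  have h2 := Real.sq_sqrt ht.le
  simp only [Pi.div_apply]
  rw [div_pow, show √t ^ 3 = t * √t by rw [pow_succ, h2], ← mul_div_mul_left _ (√t) ht.ne',
    ← sub_div, div_div_div_cancel_right₀ (by positivity)]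
  congr 1
  ring

lemma integral_E3_eq (f : ℝ → ℝ) :
    ((2 * π) ^ 3)⁻¹ * ∫ p : E3, f ‖p‖ = (2 * π ^ 2)⁻¹ * ∫ r in Ioi (0 : ℝ), r ^ 2 * f r := by
  have hv : (volume : Measure E3).real (Metric.ball 0 1) = π * 4 / 3 := by
    rw [measureReal_def, EuclideanSpace.volume_ball_fin_three]
    simp
    positivity
  rw [integral_fun_norm_addHaar, hv]
  simp only [finrank_euclideanSpace, Fintype.card_fin, smul_eq_mul, nsmul_eq_mul]
  push_cast
  field_simp
  norm_num

lemma density_eq (m : ℝ) :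
    ((2 * π) ^ 3)⁻¹ * (∫ p : E3, (Real.exp (‖p‖ ^ 2 - m) - 1)⁻¹)
      = (2 * π ^ 2)⁻¹ * radialDensity (-m) :=
  integral_E3_eq fun r => (Real.exp (r ^ 2 - m) - 1)⁻¹

lemma nfc_eq : nfc = (2 * π ^ 2)⁻¹ * radialDensity 0 := by
  simpa [nfc] using density_eq 0

lemma log_integral_eq (m : ℝ) :
    ((2 * π) ^ 3)⁻¹ * (∫ p : E3, Real.log (1 - Real.exp (-(‖p‖ ^ 2 - m))))
      = (2 * π ^ 2)⁻¹ * radialLog (-m) :=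
  integral_E3_eq fun r => Real.log (1 - Real.exp (-(r ^ 2 - m)))

lemma fmin_eq : fmin = (2 * π ^ 2)⁻¹ * radialLog 0 := by
  simpa [fmin] using log_integral_eq 0

lemma mOf_spec {n : ℝ}
    (h : ∃ m : ℝ, m ≤ 0 ∧ ((2 * π) ^ 3)⁻¹ * (∫ p : E3, (Real.exp (‖p‖ ^ 2 - m) - 1)⁻¹) = n) :
    mOf n ≤ 0 ∧ (2 * π ^ 2)⁻¹ * radialDensity (-mOf n) = n := by
  rw [← density_eq]
  unfold mOf
  rw [dif_pos h]
  exact h.choose_spec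

lemma exists_density_lt {ε : ℝ} (hε : 0 < ε) :
    ∃ t ∈ Ioo 0 ε, radialDensity t < radialDensity 0 := by
  have h := tendsto_density_deficit.eventually (lt_mem_nhds (show 0 < π / 2 by positivity))
  obtain ⟨t, ht, ht'⟩ := (h.and (Ioo_mem_nhdsGT hε)).exists
  refine ⟨t, ht', ?_⟩
  have := (div_pos_iff_of_pos_right (Real.sqrt_pos.2 ht'.1)).1 ht
  linarith

lemma eventually_mOf {ε : ℝ} (hε : 0 < ε) :
    ∀ᶠ n in 𝓝[<] nfc, -mOf n ∈ Ioo 0 ε ∧ (2 * π ^ 2)⁻¹ * radialDensity (-mOf n) = n := by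
  have hK : 0 < (2 * π ^ 2)⁻¹ := by positivity
  obtain ⟨t, ht, hlt⟩ := exists_density_lt hε
  have hlt' : (2 * π ^ 2)⁻¹ * radialDensity t < nfc := by
    rw [nfc_eq]
    exact mul_lt_mul_of_pos_left hlt hK
  filter_upwards [Ioo_mem_nhdsLT hlt'] with n hn
  have hex : ∃ m : ℝ, m ≤ 0 ∧
      ((2 * π) ^ 3)⁻¹ * (∫ p : E3, (Real.exp (‖p‖ ^ 2 - m) - 1)⁻¹) = n := by
    have hc : ContinuousOn (fun s => (2 * π ^ 2)⁻¹ * radialDensity s) (Icc 0 t) :=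
      (continuousOn_radialDensity.mono Icc_subset_Ici_self).const_mul _
    obtain ⟨s, hs, hsn⟩ := intermediate_value_Icc' ht.1.le hc
      ⟨hn.1.le, nfc_eq ▸ hn.2.le⟩
    refine ⟨-s, by linarith [hs.1], ?_⟩
    rw [density_eq, neg_neg]
    exact hsn
  obtain ⟨h1, h2⟩ := mOf_spec hex
  refine ⟨⟨lt_of_le_of_ne (by linarith) fun h0 => ?_, ?_⟩, h2⟩
  · rw [← h0, ← nfc_eq] at h2
    exact hn.2.ne' h2
  · by_contra! hge
    have h3 := antitoneOn_radialDensity (mem_Ici.2 ht.1.le)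
      (mem_Ici.2 (by linarith)) (ht.2.le.trans hge)
    have h4 := mul_le_mul_of_nonneg_left h3 hK.le
    rw [h2] at h4
    exact absurd hn.1 (not_lt.2 h4)

lemma tendsto_neg_mOf : Tendsto (fun n => -mOf n) (𝓝[<] nfc) (𝓝[>] 0) := by
  refine (nhdsGT_basis (0 : ℝ)).tendsto_right_iff.2 fun ε hε => ?_
  exact (eventually_mOf hε).mono fun n hn => hn.1

/-- third-order expansion of the free Bose gas energy at the critical
density: `(f₀(n) - f_min)/(n_fc - n)³ → 16π²/3` as `n → n_fc⁻`. -/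
theorem free_gas_energy_third_order :
    Tendsto (fun n : ℝ => (f0 n - fmin) / (nfc - n) ^ 3)
      (nhdsWithin nfc (Set.Iio nfc)) (nhds (16 * π ^ 2 / 3)) := by
  have h := (tendsto_energy_ratio.comp tendsto_neg_mOf).const_mul ((2 * π ^ 2) ^ 2)
  have hc : (2 * π ^ 2) ^ 2 * (4 / (3 * π ^ 2)) = 16 * π ^ 2 / 3 := by
    field_simp
    ring
  rw [hc] at h
  refine h.congr' ?_
  filter_upwards [eventually_mOf one_pos] with n hn
  have h2 := hn.2
  have hf : f0 n - fmin = (2 * π ^ 2)⁻¹ *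
      (radialLog (-mOf n) - radialLog 0 - -mOf n * radialDensity (-mOf n)) := by
    unfold f0
    rw [log_integral_eq, fmin_eq]
    linear_combination -mOf n * h2
  have hd : nfc - n = (2 * π ^ 2)⁻¹ * (radialDensity 0 - radialDensity (-mOf n)) := by
    rw [nfc_eq]
    linear_combination h2
  rw [hf, hd, mul_pow _ (radialDensity 0 - _), mul_div_mul_comm, Function.comp_apply]
  congr 1
  field_simp
end

section
/- Square-root asymptotics of the Bose density change: lim_{λ → 0⁺} λ^{−1/2} (2π)^{-3} ∫_{ℝ³} [(e^{p²} − 1)^{-1} − (e^{p² + λ} − 1)^{-1}] dp = 1/(4π). -/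
open MeasureTheory Real Filter

theorem mul_exp_half_le_exp_sub_one {x : ℝ} (hx : 0 ≤ x) :
    x * exp (x / 2) ≤ exp x - 1 := by
  have h := Real.self_le_sinh_iff.mpr (show 0 ≤ x / 2 by positivity)
  rw [Real.sinh_eq] at h
  have h1 : exp (x / 2) * exp (x / 2) = exp x := by rw [← Real.exp_add]; ring_nf
  have h2 : exp (-(x / 2)) * exp (x / 2) = 1 := by rw [← Real.exp_add]; simp
  nlinarith [Real.exp_pos (x / 2)]

theorem bose_sub_nonneg {a l : ℝ} (ha : 0 < a) (hl : 0 < l) :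
    0 ≤ (exp a - 1)⁻¹ - (exp (a + l) - 1)⁻¹ := by
  have h1 : 1 < exp a := Real.one_lt_exp_iff.mpr ha
  have h2 : exp a ≤ exp (a + l) := Real.exp_le_exp.mpr (by linarith)
  rw [sub_nonneg]
  exact inv_anti₀ (by linarith) (by linarith)

theorem bose_sub_le {a l : ℝ} (ha : 0 < a) (hl : 0 < l) (hl1 : l ≤ 1) :
    (exp a - 1)⁻¹ - (exp (a + l) - 1)⁻¹ ≤ 2 * l / (a * (a + l)) := by
  have hb : 0 < a + l := by positivity
  have h1 : 0 < exp a - 1 := sub_pos.mpr (Real.one_lt_exp_iff.mpr ha)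
  have h2 : 0 < exp (a + l) - 1 := sub_pos.mpr (Real.one_lt_exp_iff.mpr hb)
  have hprod : a * (a + l) * (exp (a / 2) * exp ((a + l) / 2)) ≤
      (exp a - 1) * (exp (a + l) - 1) := by
    calc _ = (a * exp (a / 2)) * ((a + l) * exp ((a + l) / 2)) := by ring
      _ ≤ _ := mul_le_mul (mul_exp_half_le_exp_sub_one ha.le)
          (mul_exp_half_le_exp_sub_one hb.le) (by positivity) h1.le
  have hsplit : exp (a + l) = exp (a / 2) * exp ((a + l) / 2) * exp (l / 2) := by
    rw [← Real.exp_add, ← Real.exp_add]; ring_nf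
  have hhalf : exp (l / 2) ≤ 2 := by
    have h := Real.exp_bound_div_one_sub_of_interval (x := l / 2) (by positivity) (by linarith)
    refine h.trans ?_
    rw [div_le_iff₀ (by linarith)]
    linarith
  have hdiff : exp (a + l) - exp a ≤ l * exp (a + l) := by
    have h : exp a = exp (a + l) * exp (-l) := by rw [← Real.exp_add]; ring_nf
    nlinarith [Real.add_one_le_exp (-l), Real.exp_pos (a + l)]
  rw [inv_sub_inv h1.ne' h2.ne', div_le_div_iff₀ (by positivity) (by positivity)]
  calc (exp (a + l) - 1 - (exp a - 1)) * (a * (a + l))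
      ≤ (l * exp (a + l)) * (a * (a + l)) := by gcongr; linarith
    _ = l * exp (l / 2) * (a * (a + l) * (exp (a / 2) * exp ((a + l) / 2))) := by
        rw [hsplit]; ring
    _ ≤ l * 2 * ((exp a - 1) * (exp (a + l) - 1)) := by gcongr
    _ = _ := by ring

theorem tendsto_div_exp_mul_sub_one {c : ℝ} (hc : c ≠ 0) :
    Tendsto (fun l : ℝ => l * (exp (l * c) - 1)⁻¹) (nhdsWithin 0 (Set.Ioi 0)) (nhds c⁻¹) := by
  have hd : HasDerivAt (fun l : ℝ => exp (l * c)) c 0 := by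
    simpa using ((hasDerivAt_id (0 : ℝ)).mul_const c).exp
  have h := ((hasDerivAt_iff_tendsto_slope.mp hd).mono_left
    (nhdsWithin_mono 0 fun x (hx : 0 < x) => hx.ne')).inv₀ hc
  refine h.congr fun l => ?_
  simp [slope_def_field, div_eq_mul_inv, mul_comm]

theorem integral_bose_sub_eq_scaled {l : ℝ} (hl : 0 < l) :
    (∫ p : E3, ((exp (‖p‖ ^ 2) - 1)⁻¹ - (exp (‖p‖ ^ 2 + l) - 1)⁻¹)) =
      4 * π * (√l * ∫ x in Set.Ioi (0 : ℝ),
        l * x ^ 2 * ((exp (l * x ^ 2) - 1)⁻¹ - (exp (l * x ^ 2 + l) - 1)⁻¹)) := by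
  have hpolar := integral_fun_norm_addHaar (volume : Measure E3)
    (fun y : ℝ => (exp (y ^ 2) - 1)⁻¹ - (exp (y ^ 2 + l) - 1)⁻¹)
  have hvol : (volume : Measure E3).real (Metric.ball 0 1) = π * 4 / 3 := by
    rw [Measure.real, EuclideanSpace.volume_ball_fin_three]
    simp only [ENNReal.ofReal_one, one_pow, one_mul]
    exact ENNReal.toReal_ofReal (by positivity)
  have hs : 0 < √l := Real.sqrt_pos.mpr hl
  have hscale := integral_comp_mul_left_Ioi
    (fun y : ℝ => y ^ 2 * ((exp (y ^ 2) - 1)⁻¹ - (exp (y ^ 2 + l) - 1)⁻¹)) 0 hs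
  simp only [mul_pow, Real.sq_sqrt hl.le, mul_zero, smul_eq_mul] at hscale
  rw [hpolar, hvol, hscale, mul_inv_cancel_left₀ hs.ne']
  simp only [finrank_euclideanSpace, Fintype.card_fin, smul_eq_mul, nsmul_eq_mul]
  push_cast
  ring

theorem tendsto_integral_scaled_bose_sub :
    Tendsto (fun l : ℝ => ∫ x in Set.Ioi (0 : ℝ),
        l * x ^ 2 * ((exp (l * x ^ 2) - 1)⁻¹ - (exp (l * x ^ 2 + l) - 1)⁻¹))
      (nhdsWithin 0 (Set.Ioi 0)) (nhds (π / 2)) := by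
  have hval : ∫ x in Set.Ioi (0 : ℝ), (1 + x ^ 2)⁻¹ = π / 2 := by
    simp
  rw [← hval]
  refine tendsto_integral_filter_of_dominated_convergence (fun x => 2 * (1 + x ^ 2)⁻¹)
    ?_ ?_ (integrable_inv_one_add_sq.integrableOn.const_mul 2) ?_
  · exact Eventually.of_forall fun l => Measurable.aestronglyMeasurable (by fun_prop)
  · filter_upwards [Ioc_mem_nhdsGT (zero_lt_one' ℝ)] with l ⟨hl, hl1⟩
    filter_upwards [ae_restrict_mem measurableSet_Ioi] with x hx
    have hx' : 0 < x := hx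
    have ha : 0 < l * x ^ 2 := by positivity
    rw [Real.norm_of_nonneg (mul_nonneg ha.le (bose_sub_nonneg ha hl))]
    calc _ ≤ l * x ^ 2 * (2 * l / (l * x ^ 2 * (l * x ^ 2 + l))) := by
          gcongr; exact bose_sub_le ha hl hl1
      _ = _ := by field_simp; ring
  · filter_upwards [ae_restrict_mem measurableSet_Ioi] with x hx
    have hx' : 0 < x := hx
    have h1 := tendsto_div_exp_mul_sub_one (c := x ^ 2) (by positivity)
    have h2 := tendsto_div_exp_mul_sub_one (c := x ^ 2 + 1) (by positivity)
    convert (h1.sub h2).const_mul (x ^ 2) using 1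
    · ext l
      rw [mul_add_one l]
      ring
    · congr 1
      field_simp
      ring

/-- square-root asymptotics of the Bose density change:
`λ^{-1/2} (2π)^{-3} ∫ [(e^{p²}-1)^{-1} - (e^{p²+λ}-1)^{-1}] dp → 1/(4π)` as `λ → 0⁺`. -/
theorem bose_density_change_asymptotics :
    Tendsto
      (fun l : ℝ =>
        (((2 * π) ^ 3)⁻¹ *
            ∫ p : E3, ((Real.exp (‖p‖ ^ 2) - 1)⁻¹ - (Real.exp (‖p‖ ^ 2 + l) - 1)⁻¹))
          / l ^ ((1:ℝ)/2))
      (nhdsWithin 0 (Set.Ioi 0)) (nhds (1 / (4 * π))) := by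
  have hlim := tendsto_integral_scaled_bose_sub.const_mul (((2 * π) ^ 3)⁻¹ * (4 * π))
  have hconst : ((2 * π) ^ 3)⁻¹ * (4 * π) * (π / 2) = 1 / (4 * π) := by
    field_simp
    norm_num
  rw [hconst] at hlim
  refine hlim.congr' ?_
  filter_upwards [self_mem_nhdsWithin] with l hl
  have hs : 0 < √l := Real.sqrt_pos.mpr hl
  rw [integral_bose_sub_eq_scaled hl, ← Real.sqrt_eq_rpow]
  field_simp
end

section
/- λ^{3/2} asymptotics of the Bose free energy change: lim_{λ → 0⁺} λ^{−3/2} [ (2π)^{-3} ∫_{ℝ³} (ln(1 − e^{−(p² + λ)}) − ln(1 − e^{−p²})) dp − λ (2π)^{-3} ∫_{ℝ³} (e^{p² + λ} − 1)^{-1} dp ] = 1/(12π). -/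
open MeasureTheory Real Filter

noncomputable section

/-- The first-order Taylor remainder of `x ↦ log (1 - exp (-x))` between `s` and `s + l`,
expanded at `s + l`. -/
def boseRemainder (s l : ℝ) : ℝ :=
  log (1 - exp (-(s + l))) - log (1 - exp (-s)) - l * (exp (s + l) - 1)⁻¹

/-- The first-order Taylor remainder of `log` between `s` and `s + l`, expanded at `s + l`. -/
def logRemainder (s l : ℝ) : ℝ :=
  log (s + l) - log s - l * (s + l)⁻¹

/-- An antiderivative of `r ↦ r ^ 2 * logRemainder (r ^ 2) 1`. -/
def logRemainderPrimitive (r : ℝ) : ℝ :=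
  r ^ 3 / 3 * log (1 + r ^ 2) - 2 / 3 * (r ^ 2 * (r * log r)) - r / 3 + arctan r / 3

end

lemma mul_deriv_le_sub_of_antitoneOn {f f' : ℝ → ℝ}
    (hf : ∀ x, 0 < x → HasDerivAt f (f' x) x) (hf' : AntitoneOn f' (Set.Ioi 0))
    {s l : ℝ} (hs : 0 < s) (hl : 0 < l) : l * f' (s + l) ≤ f (s + l) - f s := by
  obtain ⟨c, hc, h⟩ := exists_hasDerivAt_eq_slope f f' (a := s) (b := s + l) (by linarith)
    (fun x hx => (hf x (hs.trans_le hx.1)).continuousAt.continuousWithinAt)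
    (fun x hx => hf x (hs.trans hx.1))
  have hle : f' (s + l) ≤ f' c :=
    hf' (Set.mem_Ioi.2 (hs.trans hc.1)) (Set.mem_Ioi.2 (by linarith)) hc.2.le
  rw [h, le_div_iff₀ (by linarith)] at hle
  linarith

lemma hasDerivAt_log_one_sub_exp_neg {x : ℝ} (hx : 0 < x) :
    HasDerivAt (fun x : ℝ => log (1 - exp (-x))) (exp x - 1)⁻¹ x := by
  have h1 : exp (-x) < 1 := by rw [exp_lt_one_iff]; linarith
  have h2 : 1 < exp x := one_lt_exp_iff.2 hx
  have h := (((hasDerivAt_id' x).fun_neg.exp).const_sub 1).log (by linarith)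
  refine h.congr_deriv ?_
  rw [exp_neg] at h1 ⊢
  have h3 : exp x - 1 ≠ 0 := by linarith
  have h4 : 1 - (exp x)⁻¹ ≠ 0 := by linarith
  field_simp

lemma mul_sq_exp_le_exp_sub_one_sq {x : ℝ} (hx : 0 ≤ x) :
    x ^ 2 * exp x ≤ (exp x - 1) ^ 2 := by
  have h : x / 2 ≤ sinh (x / 2) := self_le_sinh_iff.2 (by linarith)
  have hexp : exp x = exp (x / 2) ^ 2 := by
    rw [← exp_nat_mul]
    congr 1
    push_cast
    ring
  have hpos := exp_pos (x / 2)
  have hle : x * exp (x / 2) ≤ exp x - 1 := by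
    rw [sinh_eq, exp_neg] at h
    have := mul_le_mul_of_nonneg_right h hpos.le
    field_simp at this
    rw [hexp]
    linarith
  calc x ^ 2 * exp x = (x * exp (x / 2)) ^ 2 := by rw [hexp]; ring
    _ ≤ (exp x - 1) ^ 2 := pow_le_pow_left₀ (by positivity) hle 2

lemma antitoneOn_inv_exp_sub_one :
    AntitoneOn (fun x : ℝ => (exp x - 1)⁻¹) (Set.Ioi 0) := by
  intro x hx y hy hxy
  have h2 : 1 < exp x := one_lt_exp_iff.2 hx
  have := exp_le_exp.2 hxy
  exact inv_anti₀ (by linarith) (by linarith)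

lemma antitoneOn_inv_sub_inv_exp_sub_one :
    AntitoneOn (fun x : ℝ => x⁻¹ - (exp x - 1)⁻¹) (Set.Ioi 0) := by
  have hd : ∀ x : ℝ, 0 < x → HasDerivAt (fun x : ℝ => x⁻¹ - (exp x - 1)⁻¹)
      (-(x ^ 2)⁻¹ - -exp x / (exp x - 1) ^ 2) x := fun x hx => by
    have h2 : 1 < exp x := one_lt_exp_iff.2 hx
    exact (hasDerivAt_inv hx.ne').sub (((hasDerivAt_exp x).sub_const 1).fun_inv (by linarith))
  refine antitoneOn_of_deriv_nonpos (convex_Ioi 0)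
    (fun x hx => (hd x hx).continuousAt.continuousWithinAt)
    (fun x hx => (hd x (by simpa using hx)).differentiableAt.differentiableWithinAt) ?_
  intro x hx
  have hx : 0 < x := by simpa using hx
  have h2 : 1 < exp x := one_lt_exp_iff.2 hx
  rw [(hd x hx).deriv]
  have : exp x / (exp x - 1) ^ 2 ≤ (x ^ 2)⁻¹ := by
    rw [inv_eq_one_div, div_le_div_iff₀ (by nlinarith) (by positivity)]
    linarith [mul_sq_exp_le_exp_sub_one_sq hx.le]
  rw [neg_div]
  linarith

lemma boseRemainder_nonneg {s l : ℝ} (hs : 0 < s) (hl : 0 < l) : 0 ≤ boseRemainder s l := by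
  have := mul_deriv_le_sub_of_antitoneOn (fun x hx => hasDerivAt_log_one_sub_exp_neg hx)
    antitoneOn_inv_exp_sub_one hs hl
  simp only [boseRemainder]
  linarith

lemma boseRemainder_le_logRemainder {s l : ℝ} (hs : 0 < s) (hl : 0 < l) :
    boseRemainder s l ≤ logRemainder s l := by
  have := mul_deriv_le_sub_of_antitoneOn
    (fun x hx => (hasDerivAt_log hx.ne').fun_sub (hasDerivAt_log_one_sub_exp_neg hx))
    antitoneOn_inv_sub_inv_exp_sub_one hs hl
  simp only [boseRemainder, logRemainder]
  linarith

lemma logRemainder_mul {s l : ℝ} (hs : 0 < s) (hl : 0 < l) :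
    logRemainder (l * s) l = logRemainder s 1 := by
  have h : l * s + l = l * (s + 1) := by ring
  simp only [logRemainder]
  rw [h, log_mul hl.ne' (by linarith), log_mul hl.ne' hs.ne']
  field_simp
  ring

lemma logRemainder_nonneg {s l : ℝ} (hs : 0 < s) (hl : 0 < l) : 0 ≤ logRemainder s l :=
  (boseRemainder_nonneg hs hl).trans (boseRemainder_le_logRemainder hs hl)

lemma tendsto_one_sub_exp_neg_mul_div (a : ℝ) :
    Tendsto (fun l : ℝ => (1 - exp (-(l * a))) / l) (nhdsWithin 0 (Set.Ioi 0)) (nhds a) := by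
  have h : HasDerivAt (fun l : ℝ => 1 - exp (-(l * a))) a 0 := by
    have := (((hasDerivAt_id (0 : ℝ)).mul_const a).fun_neg.exp).const_sub 1
    simpa using this
  have := h.tendsto_slope_zero_right
  simpa [div_eq_inv_mul] using this

lemma tendsto_boseRemainder_mul {s : ℝ} (hs : 0 < s) :
    Tendsto (fun l : ℝ => boseRemainder (l * s) l) (nhdsWithin 0 (Set.Ioi 0))
      (nhds (logRemainder s 1)) := by
  have ha := tendsto_one_sub_exp_neg_mul_div (s + 1)
  have hb := tendsto_one_sub_exp_neg_mul_div s
  have hs1 : s + 1 ≠ 0 := by linarith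
  have hexp : Tendsto (fun l : ℝ => exp (-(l * (s + 1)))) (nhdsWithin 0 (Set.Ioi 0)) (nhds 1) := by
    have : ContinuousAt (fun l : ℝ => exp (-(l * (s + 1)))) 0 := by fun_prop
    simpa [ContinuousAt] using this.tendsto.mono_left nhdsWithin_le_nhds
  have h := ((ha.log hs1).sub (hb.log hs.ne')).sub (hexp.mul (ha.inv₀ hs1))
  refine (h.congr' ?_)
  filter_upwards [self_mem_nhdsWithin] with l hl
  have hl : 0 < l := hl
  have hpos : ∀ a : ℝ, 0 < a → 0 < 1 - exp (-(l * a)) := fun a ha => by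
    have : exp (-(l * a)) < 1 := by
      rw [exp_lt_one_iff]
      have := mul_pos hl ha
      linarith
    linarith
  have h1 := hpos (s + 1) (by linarith)
  have h2 := hpos s hs
  have e : l * s + l = l * (s + 1) := by ring
  rw [boseRemainder, e, log_div h1.ne' hl.ne', log_div h2.ne' hl.ne']
  have h3 : exp (-(l * (s + 1))) * ((1 - exp (-(l * (s + 1)))) / l)⁻¹
      = l * (exp (l * (s + 1)) - 1)⁻¹ := by
    rw [exp_neg] at h1 ⊢
    have h4 : exp (l * (s + 1)) - 1 ≠ 0 := by
      have := one_lt_exp_iff.2 (show 0 < l * (s + 1) by positivity)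
      linarith
    have h5 := h1.ne'
    field_simp
  rw [h3]
  ring

lemma continuous_logRemainderPrimitive : Continuous logRemainderPrimitive := by
  have h : Continuous fun r : ℝ => log (1 + r ^ 2) :=
    Continuous.log (by fun_prop) (fun r => by positivity)
  have h2 := continuous_mul_log
  unfold logRemainderPrimitive
  fun_prop

lemma hasDerivAt_logRemainderPrimitive {r : ℝ} (hr : 0 < r) :
    HasDerivAt logRemainderPrimitive (r ^ 2 * logRemainder (r ^ 2) 1) r := by
  have hp : HasDerivAt (fun r : ℝ => 1 + r ^ 2) (2 * r) r := by
    simpa using (hasDerivAt_pow 2 r).const_add 1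
  have hl := hp.log (by positivity)
  have h1 := ((hasDerivAt_pow 3 r).div_const 3).fun_mul hl
  have h2 := ((hasDerivAt_pow 2 r).fun_mul (hasDerivAt_mul_log hr.ne')).const_mul (2 / 3)
  have h3 := (hasDerivAt_id' r).div_const 3
  have h4 := (hasDerivAt_arctan r).div_const 3
  have h := ((h1.fun_sub h2).fun_sub h3).fun_add h4
  refine h.congr_deriv ?_
  simp only [logRemainder, log_pow, add_comm (r ^ 2) 1]
  have : 1 + r ^ 2 ≠ 0 := by positivity
  push_cast
  field_simp
  ring

lemma tendsto_logRemainderPrimitive_atTop :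
    Tendsto logRemainderPrimitive atTop (nhds (π / 6)) := by
  have harc : Tendsto (fun r => arctan r / 3) atTop (nhds (π / 6)) := by
    have := (tendsto_arctan_atTop.mono_right nhdsWithin_le_nhds).div_const 3
    convert this using 2
    ring
  have hrest : Tendsto (fun r : ℝ => logRemainderPrimitive r - arctan r / 3) atTop (nhds 0) := by
    have hinv : Tendsto (fun r : ℝ => -r⁻¹) atTop (nhds 0) := by
      simpa using (tendsto_inv_atTop_zero (𝕜 := ℝ)).neg
    refine tendsto_of_tendsto_of_tendsto_of_le_of_le' hinv tendsto_const_nhds ?_ ?_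
    all_goals
      filter_upwards [eventually_gt_atTop 0] with r hr
      have hq : 0 < (1 + r ^ 2) / r ^ 2 := by positivity
      have e : logRemainderPrimitive r - arctan r / 3
          = r ^ 3 / 3 * log ((1 + r ^ 2) / r ^ 2) - r / 3 := by
        rw [log_div (by positivity) (by positivity), log_pow, logRemainderPrimitive]
        push_cast
        ring
      rw [e]
    · have h := mul_le_mul_of_nonneg_left (one_sub_inv_le_log_of_pos hq)
        (show 0 ≤ r ^ 3 / 3 by positivity)
      have h2 : r ^ 3 / 3 * (1 - ((1 + r ^ 2) / r ^ 2)⁻¹) - r / 3 = -(r / (3 * (1 + r ^ 2))) := by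
        field_simp
        ring
      have h3 : r / (3 * (1 + r ^ 2)) ≤ r⁻¹ := by
        rw [inv_eq_one_div, div_le_div_iff₀ (by positivity) hr]
        nlinarith
      linarith
    · have h := mul_le_mul_of_nonneg_left (log_le_sub_one_of_pos hq)
        (show 0 ≤ r ^ 3 / 3 by positivity)
      have h2 : r ^ 3 / 3 * ((1 + r ^ 2) / r ^ 2 - 1) = r / 3 := by
        field_simp
        ring
      linarith
  simpa using hrest.add harc

lemma integrableOn_sq_mul_logRemainder :
    IntegrableOn (fun r : ℝ => r ^ 2 * logRemainder (r ^ 2) 1) (Set.Ioi 0) :=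
  integrableOn_Ioi_deriv_of_nonneg continuous_logRemainderPrimitive.continuousWithinAt
    (fun _ hr => hasDerivAt_logRemainderPrimitive hr)
    (fun r hr => mul_nonneg (sq_nonneg r) (logRemainder_nonneg (pow_pos hr 2) one_pos))
    tendsto_logRemainderPrimitive_atTop

lemma integral_sq_mul_logRemainder :
    ∫ r in Set.Ioi (0 : ℝ), r ^ 2 * logRemainder (r ^ 2) 1 = π / 6 := by
  rw [integral_Ioi_of_hasDerivAt_of_nonneg continuous_logRemainderPrimitive.continuousWithinAt
    (fun _ hr => hasDerivAt_logRemainderPrimitive hr)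
    (fun r hr => mul_nonneg (sq_nonneg r) (logRemainder_nonneg (pow_pos hr 2) one_pos))
    tendsto_logRemainderPrimitive_atTop]
  simp [logRemainderPrimitive]

lemma integrable_logRemainder_norm_sq :
    Integrable (fun p : E3 => logRemainder (‖p‖ ^ 2) 1) := by
  refine (integrable_fun_norm_addHaar (volume : Measure E3)
    (f := fun r => logRemainder (r ^ 2) 1)).2 ?_
  simpa using integrableOn_sq_mul_logRemainder

lemma integral_logRemainder_norm_sq :
    ∫ p : E3, logRemainder (‖p‖ ^ 2) 1 = 2 * π ^ 2 / 3 := by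
  rw [integral_fun_norm_addHaar (volume : Measure E3) (fun r => logRemainder (r ^ 2) 1)]
  have hv : (volume : Measure E3).real (Metric.ball 0 1) = π * 4 / 3 := by
    rw [Measure.real, EuclideanSpace.volume_ball_fin_three]
    simp [ENNReal.toReal_ofReal (show 0 ≤ π * 4 / 3 by positivity)]
  rw [hv]
  simp only [finrank_euclideanSpace, Fintype.card_fin, smul_eq_mul, nsmul_eq_mul]
  rw [integral_sq_mul_logRemainder]
  push_cast
  ring

lemma measurable_boseRemainder (l : ℝ) : Measurable fun s => boseRemainder s l := by
  unfold boseRemainder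
  fun_prop

lemma ae_norm_sq_pos : ∀ᵐ p : E3, 0 < ‖p‖ ^ 2 := by
  filter_upwards [compl_mem_ae_iff.2 (measure_singleton (0 : E3))] with p hp
  have : p ≠ 0 := hp
  positivity

lemma ae_norm_boseRemainder_mul_le {l : ℝ} (hl : 0 < l) :
    ∀ᵐ p : E3, ‖boseRemainder (l * ‖p‖ ^ 2) l‖ ≤ logRemainder (‖p‖ ^ 2) 1 := by
  filter_upwards [ae_norm_sq_pos] with p hp
  rw [norm_of_nonneg (boseRemainder_nonneg (mul_pos hl hp) hl), ← logRemainder_mul hp hl]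
  exact boseRemainder_le_logRemainder (mul_pos hl hp) hl

lemma aestronglyMeasurable_boseRemainder_mul (l : ℝ) :
    AEStronglyMeasurable (fun p : E3 => boseRemainder (l * ‖p‖ ^ 2) l) :=
  ((measurable_boseRemainder l).comp (by fun_prop :
    Measurable fun p : E3 => l * ‖p‖ ^ 2)).aestronglyMeasurable

lemma norm_sqrt_smul_sq {l : ℝ} (hl : 0 ≤ l) (p : E3) : ‖√l • p‖ ^ 2 = l * ‖p‖ ^ 2 := by
  rw [norm_smul, mul_pow, norm_of_nonneg (sqrt_nonneg l), sq_sqrt hl]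

lemma integrable_boseRemainder {l : ℝ} (hl : 0 < l) :
    Integrable (fun p : E3 => boseRemainder (‖p‖ ^ 2) l) := by
  rw [← integrable_comp_smul_iff volume _ (sqrt_pos.2 hl).ne']
  simp only [norm_sqrt_smul_sq hl.le]
  exact integrable_logRemainder_norm_sq.mono' (aestronglyMeasurable_boseRemainder_mul l)
    (ae_norm_boseRemainder_mul_le hl)

lemma integral_boseRemainder {l : ℝ} (hl : 0 < l) :
    ∫ p : E3, boseRemainder (‖p‖ ^ 2) l
      = l ^ ((3 : ℝ) / 2) * ∫ p : E3, boseRemainder (l * ‖p‖ ^ 2) l := by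
  have h := Measure.integral_comp_smul (volume : Measure E3)
    (fun p : E3 => boseRemainder (‖p‖ ^ 2) l) (√l)
  have hpow : √l ^ 3 = l ^ ((3 : ℝ) / 2) := by
    rw [sqrt_eq_rpow, ← rpow_natCast, ← rpow_mul hl.le]
    norm_num
  have hp : 0 < l ^ ((3 : ℝ) / 2) := rpow_pos_of_pos hl _
  simp only [norm_sqrt_smul_sq hl.le, finrank_euclideanSpace, Fintype.card_fin, hpow,
    abs_of_pos (inv_pos.2 hp), smul_eq_mul] at h
  rw [h, mul_inv_cancel_left₀ hp.ne']

lemma integrable_exp_neg_norm_sq : Integrable (fun p : E3 => exp (-‖p‖ ^ 2)) := by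
  have h := (GaussianFourier.integrable_cexp_neg_mul_sq_norm_add (V := E3) (b := 1)
    (by simp) 0 0).norm
  refine h.congr (Eventually.of_forall fun p => ?_)
  simp [Complex.norm_exp, ← Complex.ofReal_pow]

lemma integrable_inv_exp_norm_sq_add_sub_one {l : ℝ} (hl : 0 < l) :
    Integrable (fun p : E3 => (exp (‖p‖ ^ 2 + l) - 1)⁻¹) := by
  refine (integrable_exp_neg_norm_sq.mul_const (exp l - 1)⁻¹).mono'
    (Measurable.aestronglyMeasurable (by fun_prop)) (Eventually.of_forall fun p => ?_)
  have h1 : 1 < exp l := one_lt_exp_iff.2 hl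
  have h2 : 1 ≤ exp (‖p‖ ^ 2) := one_le_exp (by positivity)
  have h3 : 0 < exp (‖p‖ ^ 2) * (exp l - 1) := mul_pos (exp_pos _) (by linarith)
  have h4 : exp (‖p‖ ^ 2) * (exp l - 1) ≤ exp (‖p‖ ^ 2 + l) - 1 := by
    rw [exp_add]
    linarith
  rw [norm_of_nonneg (inv_nonneg.2 (h3.le.trans h4)), exp_neg, ← mul_inv]
  exact inv_anti₀ h3 h4

lemma integral_log_sub_log_sub {l : ℝ} (hl : 0 < l) :
    (∫ p : E3, (log (1 - exp (-(‖p‖ ^ 2 + l))) - log (1 - exp (-‖p‖ ^ 2))))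
      - l * ∫ p : E3, (exp (‖p‖ ^ 2 + l) - 1)⁻¹ = ∫ p : E3, boseRemainder (‖p‖ ^ 2) l := by
  have h := (integrable_inv_exp_norm_sq_add_sub_one hl).const_mul l
  rw [← integral_const_mul, ← integral_sub _ h]
  · rfl
  · refine ((integrable_boseRemainder hl).add h).congr (Eventually.of_forall fun p => ?_)
    simp [boseRemainder]

lemma tendsto_integral_boseRemainder_mul :
    Tendsto (fun l : ℝ => ∫ p : E3, boseRemainder (l * ‖p‖ ^ 2) l)
      (nhdsWithin 0 (Set.Ioi 0)) (nhds (2 * π ^ 2 / 3)) := by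
  rw [← integral_logRemainder_norm_sq]
  refine tendsto_integral_filter_of_dominated_convergence _
    (Eventually.of_forall aestronglyMeasurable_boseRemainder_mul) ?_
    integrable_logRemainder_norm_sq ?_
  · filter_upwards [self_mem_nhdsWithin] with l hl
    exact ae_norm_boseRemainder_mul_le hl
  · filter_upwards [ae_norm_sq_pos] with p hp
    exact tendsto_boseRemainder_mul hp

/-- `λ^{3/2}` asymptotics of the Bose free energy change:
`λ^{-3/2} [ (2π)^{-3} ∫ (ln(1-e^{-(p²+λ)}) - ln(1-e^{-p²})) dp
  - λ (2π)^{-3} ∫ (e^{p²+λ}-1)^{-1} dp ] → 1/(12π)` as `λ → 0⁺`. -/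
theorem bose_free_energy_change_asymptotics :
    Tendsto
      (fun l : ℝ =>
        (((2 * π) ^ 3)⁻¹ *
            (∫ p : E3,
              (Real.log (1 - Real.exp (-(‖p‖ ^ 2 + l)))
                - Real.log (1 - Real.exp (-‖p‖ ^ 2))))
          - l * ((2 * π) ^ 3)⁻¹ * ∫ p : E3, (Real.exp (‖p‖ ^ 2 + l) - 1)⁻¹)
          / l ^ ((3:ℝ)/2))
      (nhdsWithin 0 (Set.Ioi 0)) (nhds (1 / (12 * π))) := by
  have h := tendsto_integral_boseRemainder_mul.const_mul ((2 * π) ^ 3)⁻¹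
  have hlim : ((2 * π) ^ 3)⁻¹ * (2 * π ^ 2 / 3) = 1 / (12 * π) := by
    field_simp
    norm_num
  rw [hlim] at h
  refine h.congr' ?_
  filter_upwards [self_mem_nhdsWithin] with l hl
  have hp : 0 < l ^ ((3 : ℝ) / 2) := rpow_pos_of_pos hl _
  rw [eq_div_iff hp.ne', mul_assoc, mul_comm _ (l ^ ((3 : ℝ) / 2)), ← integral_boseRemainder hl,
    ← integral_log_sub_log_sub hl]
  ring
end

section
/- Uniform integral estimate: there exists a constant C > 0 such that for all δ₀ and b with 0 ≤ δ₀ ≤ 1 and 0 ≤ b ≤ 1, | ∫_{ℝ³} ln(1 − e^{−√((p² + δ₀)² + 2(p² + δ₀)b)}) dp − ∫_{ℝ³} ln(1 − e^{−(p² + δ₀)}) dp − b ∫_{ℝ³} (e^{p² + δ₀} − 1)^{-1} dp | ≤ C b^{3/2}. -/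
open MeasureTheory Real Filter

/-- The integrable radial majorant `1 / (‖q‖² (1 + ‖q‖²))` on momentum space. -/
noncomputable def radialMajorant (q : E3) : ℝ := (‖q‖ ^ 2 * (1 + ‖q‖ ^ 2))⁻¹

theorem radialMajorant_nonneg (q : E3) : 0 ≤ radialMajorant q := by
  unfold radialMajorant; positivity

theorem integrable_radialMajorant : Integrable radialMajorant := by
  have h := integrable_fun_norm_addHaar (volume : Measure E3)
    (f := fun y : ℝ => (y ^ 2 * (1 + y ^ 2))⁻¹)
  refine h.2 ?_
  refine (integrable_inv_one_add_sq.integrableOn (s := Set.Ioi 0)).congr_fun ?_ measurableSet_Ioi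
  intro y hy
  have hy : 0 < y := hy
  simp only [finrank_euclideanSpace, Fintype.card_fin, smul_eq_mul]
  field_simp

theorem inv_exp_sub_one_le_inv {x : ℝ} (hx : 0 < x) : (exp x - 1)⁻¹ ≤ x⁻¹ :=
  inv_anti₀ hx (by linarith [add_one_le_exp x])

theorem inv_exp_sub_one_le {x : ℝ} (hx : 0 < x) : (exp x - 1)⁻¹ ≤ 2 * (x * (1 + x))⁻¹ := by
  have h : x * (1 + x) / 2 ≤ exp x - 1 := by
    nlinarith [quadratic_le_exp_of_nonneg hx.le]
  calc (exp x - 1)⁻¹ ≤ (x * (1 + x) / 2)⁻¹ := inv_anti₀ (by positivity) h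
    _ = 2 * (x * (1 + x))⁻¹ := by rw [inv_div, div_eq_mul_inv]

theorem abs_log_one_sub_exp_neg_le {x : ℝ} (hx : 0 < x) :
    |log (1 - exp (-x))| ≤ (exp x - 1)⁻¹ := by
  have h1 : exp (-x) < 1 := exp_lt_one_iff.2 (by linarith)
  have h2 : 1 < exp x := one_lt_exp_iff.2 hx
  rw [abs_of_nonpos (log_nonpos (by linarith) (by linarith [exp_pos (-x)]))]
  have h := one_sub_inv_le_log_of_pos (sub_pos.2 h1)
  have e : 1 - (1 - exp (-x))⁻¹ = -(exp x - 1)⁻¹ := by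
    rw [exp_neg] at h1 ⊢
    have : exp x - 1 ≠ 0 := by linarith
    have : 1 - (exp x)⁻¹ ≠ 0 := by linarith
    field_simp
    ring
  linarith

theorem log_one_sub_exp_neg_sub_le {x y : ℝ} (hx : 0 < x) (hy : 0 < y) :
    log (1 - exp (-y)) - log (1 - exp (-x)) ≤ (y - x) * (exp x - 1)⁻¹ := by
  have h1 : 0 < 1 - exp (-x) := sub_pos.2 (exp_lt_one_iff.2 (by linarith))
  have h2 : 0 < 1 - exp (-y) := sub_pos.2 (exp_lt_one_iff.2 (by linarith))
  have h3 : 0 < exp x - 1 := sub_pos.2 (one_lt_exp_iff.2 hx)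
  rw [← log_div h2.ne' h1.ne']
  refine (log_le_sub_one_of_pos (div_pos h2 h1)).trans ?_
  have e : (1 - exp (-y)) / (1 - exp (-x)) - 1 = (1 - exp (-(y - x))) * (exp x - 1)⁻¹ := by
    rw [neg_sub, sub_eq_add_neg x y, exp_add, exp_neg x] at *
    field_simp
    ring
  rw [e]
  exact mul_le_mul_of_nonneg_right (by linarith [add_one_le_exp (-(y - x))]) (inv_nonneg.2 h3.le)

/-- `x ↦ (eˣ - 1)⁻¹` has slope at most `2 / x²` to the right of `x`. -/
theorem inv_exp_sub_one_sub_le {x y : ℝ} (hx : 0 < x) (hxy : x ≤ y) :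
    (exp x - 1)⁻¹ - (exp y - 1)⁻¹ ≤ (y - x) * (2 * (x ^ 2)⁻¹) := by
  have hy : 0 < y := hx.trans_le hxy
  have h3 : 0 < exp x - 1 := sub_pos.2 (one_lt_exp_iff.2 hx)
  have h4 : 0 < exp y - 1 := sub_pos.2 (one_lt_exp_iff.2 hy)
  have e : (exp x - 1)⁻¹ - (exp y - 1)⁻¹
      = (1 - exp (-(y - x))) * (1 + (exp y - 1)⁻¹) * (exp x - 1)⁻¹ := by
    rw [neg_sub, sub_eq_add_neg x y, exp_add, exp_neg y]
    field_simp
    ring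
  have hyx : (exp y - 1)⁻¹ ≤ x⁻¹ :=
    (inv_exp_sub_one_le_inv hy).trans (inv_anti₀ hx hxy)
  have hd : 1 - exp (-(y - x)) ≤ y - x := by linarith [add_one_le_exp (-(y - x))]
  have hyx0 : 0 ≤ y - x := sub_nonneg.2 hxy
  rw [e]
  calc (1 - exp (-(y - x))) * (1 + (exp y - 1)⁻¹) * (exp x - 1)⁻¹
      ≤ (y - x) * (1 + x⁻¹) * (2 * (x * (1 + x))⁻¹) := by
        gcongr
        exact inv_exp_sub_one_le hx
    _ = (y - x) * (2 * (x ^ 2)⁻¹) := by field_simp; ring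

/-- The first-order Taylor remainder in `b` of `ln (1 - e^{-√(x² + 2xb)})`. -/
noncomputable def taylorRemainder (x b : ℝ) : ℝ :=
  log (1 - exp (-√(x ^ 2 + 2 * x * b))) - log (1 - exp (-x)) - b * (exp x - 1)⁻¹

theorem abs_taylorRemainder_le {x b : ℝ} (hx : 0 < x) (hb : 0 ≤ b) :
    |taylorRemainder x b| ≤ b / x ∧ |taylorRemainder x b| ≤ 5 / 2 * (b ^ 2 / x ^ 2) := by
  unfold taylorRemainder
  set y := √(x ^ 2 + 2 * x * b) with hy_def
  have hy2 : y ^ 2 = x ^ 2 + 2 * x * b := sq_sqrt (by positivity)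
  have hxb : 0 ≤ x * b := by positivity
  have hy0 : 0 ≤ y := sqrt_nonneg _
  have hxy : x ≤ y := by nlinarith
  have hyb : y ≤ x + b := by nlinarith
  have hy : 0 < y := hx.trans_le hxy
  have h3 : 0 < (exp x - 1)⁻¹ := inv_pos.2 (sub_pos.2 (one_lt_exp_iff.2 hx))
  have h4 : 0 < (exp y - 1)⁻¹ := inv_pos.2 (sub_pos.2 (one_lt_exp_iff.2 hy))
  have hup := log_one_sub_exp_neg_sub_le hx hy
  have hlo := log_one_sub_exp_neg_sub_le hy hx
  have hslope := inv_exp_sub_one_sub_le hx hxy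
  have hyx : (exp y - 1)⁻¹ ≤ x⁻¹ :=
    (inv_exp_sub_one_le_inv hy).trans (inv_anti₀ hx hxy)
  have hdef : x + b - y ≤ b ^ 2 / (2 * x) := by
    rw [le_div_iff₀ (by positivity)]
    nlinarith
  have hnonpos : log (1 - exp (-y)) - log (1 - exp (-x)) - b * (exp x - 1)⁻¹ ≤ 0 := by
    nlinarith
  rw [abs_of_nonpos hnonpos]
  constructor
  · have h5 : b * (exp x - 1)⁻¹ ≤ b * x⁻¹ :=
      mul_le_mul_of_nonneg_left (inv_exp_sub_one_le_inv hx) hb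
    have h6 : 0 ≤ (y - x) * (exp y - 1)⁻¹ := mul_nonneg (by linarith) h4.le
    rw [div_eq_mul_inv]
    linarith
  · have h5 : b * ((exp x - 1)⁻¹ - (exp y - 1)⁻¹) ≤ b * (b * (2 * (x ^ 2)⁻¹)) :=
      mul_le_mul_of_nonneg_left (hslope.trans
        (mul_le_mul_of_nonneg_right (by linarith) (by positivity))) hb
    have h6 : (x + b - y) * (exp y - 1)⁻¹ ≤ b ^ 2 / (2 * x) * x⁻¹ :=
      mul_le_mul hdef hyx h4.le (by positivity)
    have h7 : b * (b * (2 * (x ^ 2)⁻¹)) + b ^ 2 / (2 * x) * x⁻¹ = 5 / 2 * (b ^ 2 / x ^ 2) := by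
      field_simp
      ring
    linarith

theorem norm_inv_sqrt_smul_sq {b : ℝ} (hb : 0 < b) (p : E3) :
    ‖(√b)⁻¹ • p‖ ^ 2 = ‖p‖ ^ 2 / b := by
  rw [norm_smul, mul_pow, norm_inv, norm_of_nonneg (sqrt_nonneg b), inv_pow, sq_sqrt hb.le]
  ring

theorem abs_taylorRemainder_le_radialMajorant {δ b : ℝ} (hδ : 0 ≤ δ) (hb : 0 < b) {p : E3}
    (hp : p ≠ 0) :
    |taylorRemainder (‖p‖ ^ 2 + δ) b| ≤ 7 / 2 * radialMajorant ((√b)⁻¹ • p) := by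
  have hp2 : 0 < ‖p‖ ^ 2 := by positivity
  obtain ⟨h1, h2⟩ := abs_taylorRemainder_le (add_pos_of_pos_of_nonneg hp2 hδ) hb.le
  rw [radialMajorant, norm_inv_sqrt_smul_sq hb, ← div_eq_mul_inv]
  set r := ‖p‖ ^ 2
  have h1' : |taylorRemainder (r + δ) b| ≤ b / r :=
    h1.trans (div_le_div_of_nonneg_left hb.le hp2 (by linarith))
  have h2' : |taylorRemainder (r + δ) b| ≤ 5 / 2 * (b ^ 2 / r ^ 2) := by
    refine h2.trans ?_
    gcongr
    linarith
  rw [le_div_iff₀ (by positivity)]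
  set T := |taylorRemainder (r + δ) b|
  have e1 : T * (r / b) ≤ b / r * (r / b) := by gcongr
  have e2 : T * (r / b) ^ 2 ≤ 5 / 2 * (b ^ 2 / r ^ 2) * (r / b) ^ 2 := by gcongr
  have e3 : b / r * (r / b) = 1 := by field_simp
  have e4 : 5 / 2 * (b ^ 2 / r ^ 2) * (r / b) ^ 2 = 5 / 2 := by field_simp
  nlinarith

theorem ae_ne_zero_E3 : ∀ᵐ p : E3, p ≠ 0 :=
  Measure.ae_ne volume 0

theorem inv_exp_sub_one_le_radialMajorant {δ : ℝ} (hδ : 0 ≤ δ) {p : E3} (hp : p ≠ 0) :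
    (exp (‖p‖ ^ 2 + δ) - 1)⁻¹ ≤ 2 * radialMajorant p := by
  have hp2 : 0 < ‖p‖ ^ 2 := by positivity
  refine le_trans (inv_anti₀ (sub_pos.2 (one_lt_exp_iff.2 hp2)) ?_) (inv_exp_sub_one_le hp2)
  gcongr
  linarith

theorem integrable_inv_exp_sub_one {δ : ℝ} (hδ : 0 ≤ δ) :
    Integrable fun p : E3 => (exp (‖p‖ ^ 2 + δ) - 1)⁻¹ := by
  refine (integrable_radialMajorant.const_mul 2).mono'
    (Measurable.aestronglyMeasurable (by fun_prop)) ?_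
  filter_upwards [ae_ne_zero_E3] with p hp
  rw [norm_of_nonneg (inv_nonneg.2 (sub_nonneg.2 (one_le_exp (by positivity))))]
  exact inv_exp_sub_one_le_radialMajorant hδ hp

theorem integrable_log_one_sub_exp_neg {δ : ℝ} (hδ : 0 ≤ δ) :
    Integrable fun p : E3 => log (1 - exp (-(‖p‖ ^ 2 + δ))) := by
  refine (integrable_inv_exp_sub_one hδ).mono' (Measurable.aestronglyMeasurable (by fun_prop)) ?_
  filter_upwards [ae_ne_zero_E3] with p hp
  exact abs_log_one_sub_exp_neg_le (by positivity)

theorem integrable_radialMajorant_comp_smul {b : ℝ} (hb : 0 < b) :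
    Integrable fun p : E3 => 7 / 2 * radialMajorant ((√b)⁻¹ • p) :=
  (integrable_radialMajorant.comp_smul (inv_ne_zero (sqrt_pos.2 hb).ne')).const_mul _

theorem integral_radialMajorant_comp_smul {b : ℝ} (hb : 0 < b) :
    ∫ p : E3, 7 / 2 * radialMajorant ((√b)⁻¹ • p)
      = 7 / 2 * (∫ p, radialMajorant p) * b ^ ((3 : ℝ) / 2) := by
  have hs : √b ^ 3 = b ^ ((3 : ℝ) / 2) := by
    rw [sqrt_eq_rpow, ← rpow_natCast, ← rpow_mul hb.le]
    norm_num
  rw [integral_const_mul, Measure.integral_comp_smul, finrank_euclideanSpace, Fintype.card_fin,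
    inv_pow, inv_inv, abs_of_nonneg (by positivity), hs, smul_eq_mul]
  ring

theorem integrable_taylorRemainder {δ b : ℝ} (hδ : 0 ≤ δ) (hb : 0 < b) :
    Integrable fun p : E3 => taylorRemainder (‖p‖ ^ 2 + δ) b := by
  refine (integrable_radialMajorant_comp_smul hb).mono'
    (Measurable.aestronglyMeasurable (by unfold taylorRemainder; fun_prop)) ?_
  filter_upwards [ae_ne_zero_E3] with p hp
  exact abs_taylorRemainder_le_radialMajorant hδ hb hp

theorem integral_taylorRemainder {δ b : ℝ} (hδ : 0 ≤ δ) (hb : 0 < b) :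
    ∫ p : E3, taylorRemainder (‖p‖ ^ 2 + δ) b
      = (∫ p : E3, log (1 - exp (-√((‖p‖ ^ 2 + δ) ^ 2 + 2 * (‖p‖ ^ 2 + δ) * b))))
        - (∫ p : E3, log (1 - exp (-(‖p‖ ^ 2 + δ))))
        - b * ∫ p : E3, (exp (‖p‖ ^ 2 + δ) - 1)⁻¹ := by
  have hg := integrable_log_one_sub_exp_neg hδ
  have hh := (integrable_inv_exp_sub_one hδ).const_mul b
  have hf : Integrable fun p : E3 =>
      log (1 - exp (-√((‖p‖ ^ 2 + δ) ^ 2 + 2 * (‖p‖ ^ 2 + δ) * b))) :=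
    (((integrable_taylorRemainder hδ hb).add hg).add hh).congr
      (Eventually.of_forall fun p => by simp only [Pi.add_apply, taylorRemainder]; ring)
  rw [← integral_const_mul, ← integral_sub hf hg]
  exact integral_sub (hf.sub hg) hh

/-- uniform integral estimate: for `0 ≤ δ₀ ≤ 1` and `0 ≤ b ≤ 1`,
`|∫ ln(1-e^{-√((p²+δ₀)²+2(p²+δ₀)b)}) - ∫ ln(1-e^{-(p²+δ₀)}) - b ∫ (e^{p²+δ₀}-1)^{-1}|
  ≤ C b^{3/2}`. -/
theorem uniform_integral_estimate :
    ∃ C : ℝ, 0 < C ∧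
      ∀ δ0 b : ℝ, 0 ≤ δ0 → δ0 ≤ 1 → 0 ≤ b → b ≤ 1 →
        |(∫ p : E3,
            Real.log (1 - Real.exp
              (-Real.sqrt ((‖p‖ ^ 2 + δ0) ^ 2 + 2 * (‖p‖ ^ 2 + δ0) * b))))
          - (∫ p : E3, Real.log (1 - Real.exp (-(‖p‖ ^ 2 + δ0))))
          - b * ∫ p : E3, (Real.exp (‖p‖ ^ 2 + δ0) - 1)⁻¹|
          ≤ C * b ^ ((3:ℝ)/2) := by
  have hM : 0 ≤ ∫ p, radialMajorant p := integral_nonneg radialMajorant_nonneg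
  refine ⟨7 / 2 * (∫ p, radialMajorant p) + 1, by positivity, fun δ0 b hδ _ hb _ => ?_⟩
  rcases hb.eq_or_lt with rfl | hb
  · have h (p : E3) : √((‖p‖ ^ 2 + δ0) ^ 2 + 2 * (‖p‖ ^ 2 + δ0) * 0) = ‖p‖ ^ 2 + δ0 := by
      rw [mul_zero, add_zero, sqrt_sq (by positivity)]
    simp only [h, sub_self, zero_mul, abs_zero]
    positivity
  rw [← integral_taylorRemainder hδ hb]
  have hb' : 0 ≤ b ^ ((3 : ℝ) / 2) := by positivity
  calc |∫ p : E3, taylorRemainder (‖p‖ ^ 2 + δ0) b|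
      ≤ ∫ p : E3, 7 / 2 * radialMajorant ((√b)⁻¹ • p) := by
        refine norm_integral_le_of_norm_le (f := fun p : E3 => taylorRemainder (‖p‖ ^ 2 + δ0) b)
          (integrable_radialMajorant_comp_smul hb) ?_
        filter_upwards [ae_ne_zero_E3] with p hp
        exact abs_taylorRemainder_le_radialMajorant hδ hb hp
    _ = 7 / 2 * (∫ p, radialMajorant p) * b ^ ((3 : ℝ) / 2) :=
        integral_radialMajorant_comp_smul hb
    _ ≤ (7 / 2 * (∫ p, radialMajorant p) + 1) * b ^ ((3 : ℝ) / 2) := by gcongr; linarith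
end
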